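/- arXiv:2604.19284 — 2 statements merged into one kernel-verified Lean document; each statement's English description precedes it below -/
import Mathlib

section
/- Let s ∈ [0,1), t ∈ {1,2}, and let V ∈ L¹(ℝ²) be real-valued and satisfy conditions (V_ln_s) and (V_roll). Then there exists a constant C > 0 such that for all α ∈ (0, 1/e), ∫_{Ω₂(α)} |V(x)|·|G(x,y;α) − g(α)|^t·|V(y)| d(x,y) ≤ C·|ln α|^{(t−s)/2}, where Ω₂(α) := {(x,y) ∈ ℝ²×ℝ² : 1 ≤ ln‖x−y‖ < |ln α|^{1/2}}. -/
open MeasureTheory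

/-- The modified Bessel function of the second kind of order zero,
via its integral representation `K₀(w) = ∫₀^∞ exp(−w·cosh t) dt`. -/
noncomputable def K0 (w : ℝ) : ℝ := ∫ t in Set.Ioi (0 : ℝ), Real.exp (-w * Real.cosh t)

/-- The Green's function of the free resolvent `(-Δ + α²)⁻¹` in two dimensions:
`G(x,y;α) = (1/(2π))·K₀(α‖x−y‖)`. -/
noncomputable def G (x y : EuclideanSpace ℝ (Fin 2)) (α : ℝ) : ℝ :=
  (1 / (2 * Real.pi)) * K0 (α * ‖x - y‖)

/-- The function `g(α) = −(ln α)/(2π)`. -/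
noncomputable def g (α : ℝ) : ℝ := -(Real.log α) / (2 * Real.pi)

/-- The region `Ω₂(α) = {(x,y) : 1 ≤ ln‖x−y‖ < |ln α|^{1/2}}`. -/
def Omega2 (α : ℝ) : Set (EuclideanSpace ℝ (Fin 2) × EuclideanSpace ℝ (Fin 2)) :=
  {p | 1 ≤ Real.log ‖p.1 - p.2‖ ∧ Real.log ‖p.1 - p.2‖ < Real.sqrt |Real.log α|}

lemma K0_aux (w : ℝ) (hw : 0 < w) (t : ℝ) :
    Real.exp (-w * Real.cosh t) ≤ Real.exp (Real.log w * (-1/2)) * Real.exp ((-1/2) * t) := by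
  rw [← Real.exp_add]
  apply Real.exp_le_exp.2
  have h1 : Real.log w + t + 1 ≤ w * Real.exp t := by
    have := Real.add_one_le_exp (Real.log w + t)
    rwa [Real.exp_add, Real.exp_log hw] at this
  have h2 : Real.exp t / 2 ≤ Real.cosh t := by
    rw [Real.cosh_eq]; have := Real.exp_pos (-t); linarith
  have h3 := mul_le_mul_of_nonneg_left h2 hw.le
  nlinarith

lemma K0_bound (w : ℝ) (hw : 0 < w) (hw1 : w ≤ 1) : |K0 w + Real.log w| ≤ 2 := by
  set T := -Real.log w with hT
  have hT0 : 0 ≤ T := by have := Real.log_nonpos hw.le hw1; linarith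
  have hmaj : ∀ a : ℝ, IntegrableOn (fun t => Real.exp (Real.log w * (-1/2)) * Real.exp ((-1/2) * t))
      (Set.Ioi a) := fun a =>
    (integrableOn_exp_mul_Ioi (by norm_num) a).const_mul _
  have hint : IntegrableOn (fun t => Real.exp (-w * Real.cosh t)) (Set.Ioi 0) := by
    refine (hmaj 0).mono' (Continuous.aestronglyMeasurable (by fun_prop)) ?_
    filter_upwards with t
    rw [Real.norm_eq_abs, abs_of_pos (Real.exp_pos _)]
    exact K0_aux w hw t
  have hsplit : K0 w = (∫ t in Set.Ioc 0 T, Real.exp (-w * Real.cosh t))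
      + ∫ t in Set.Ioi T, Real.exp (-w * Real.cosh t) := by
    unfold K0
    rw [← Set.Ioc_union_Ioi_eq_Ioi hT0]
    exact setIntegral_union (Set.Ioc_disjoint_Ioi le_rfl) measurableSet_Ioi
      (hint.mono_set Set.Ioc_subset_Ioi_self) (hint.mono_set (Set.Ioi_subset_Ioi hT0))
  have hwT : w * Real.exp T = 1 := by
    rw [hT, Real.exp_neg, Real.exp_log hw]; field_simp
  have htail : ∫ t in Set.Ioi T, Real.exp (-w * Real.cosh t) ≤ 2 := by
    calc _ ≤ ∫ t in Set.Ioi T, Real.exp (Real.log w * (-1/2)) * Real.exp ((-1/2) * t) :=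
          setIntegral_mono (hint.mono_set (Set.Ioi_subset_Ioi hT0)) (hmaj T) (K0_aux w hw)
      _ = 2 := by
          rw [integral_const_mul, integral_exp_mul_Ioi (by norm_num)]
          have : Real.exp (Real.log w * (-1/2)) * Real.exp ((-1/2) * T) = 1 := by
            rw [← Real.exp_add, hT, Real.exp_eq_one_iff]; ring
          linear_combination 2 * this
  have htail0 : 0 ≤ ∫ t in Set.Ioi T, Real.exp (-w * Real.cosh t) :=
    integral_nonneg fun t => (Real.exp_pos _).le
  have hup : ∫ t in Set.Ioc 0 T, Real.exp (-w * Real.cosh t) ≤ T := by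
    calc _ ≤ ∫ t in Set.Ioc 0 T, (1 : ℝ) := by
          refine setIntegral_mono (hint.mono_set Set.Ioc_subset_Ioi_self)
            (by simp) fun t => ?_
          have := Real.one_le_cosh t
          apply Real.exp_le_one_iff.2
          nlinarith
      _ = T := by simp [hT0]
  have hlo : T - 1 ≤ ∫ t in Set.Ioc 0 T, Real.exp (-w * Real.cosh t) := by
    calc T - 1 ≤ ∫ t in Set.Ioc 0 T, (1 - w * Real.exp t) := by
          rw [← intervalIntegral.integral_of_le hT0, intervalIntegral.integral_sub
            (by simp) (Continuous.intervalIntegrable (by fun_prop) _ _),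
            intervalIntegral.integral_const_mul, integral_exp]
          simp only [intervalIntegral.integral_const, smul_eq_mul, Real.exp_zero]
          nlinarith
      _ ≤ _ := by
          refine setIntegral_mono_on ?_ (hint.mono_set Set.Ioc_subset_Ioi_self)
            measurableSet_Ioc fun t ht => ?_
          · exact (Continuous.integrableOn_Ioc (by fun_prop))
          · have h1 : Real.cosh t ≤ Real.exp t := by
              rw [Real.cosh_eq]
              have : Real.exp (-t) ≤ Real.exp t := Real.exp_le_exp.2 (by linarith [ht.1])
              linarith
            have h2 := Real.add_one_le_exp (-w * Real.cosh t)
            nlinarith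
  rw [abs_le]
  constructor <;> linarith

lemma log_aux {E : Type*} [NormedAddCommGroup E] (s : ℝ) (hs : s ∈ Set.Ico (0 : ℝ) 1)
    (x y : E) (h : 1 ≤ Real.log ‖x - y‖) :
    Real.log ‖x - y‖ ^ s ≤ (1 + Real.posLog ‖x‖ ^ s) * (1 + Real.posLog ‖y‖ ^ s) := by
  have hx := Real.posLog_nonneg (x := ‖x‖)
  have hy := Real.posLog_nonneg (x := ‖y‖)
  have h0 : Real.log ‖x - y‖ ≤ 1 + (Real.posLog ‖x‖ + Real.posLog ‖y‖) := by
    have h1 : Real.log ‖x - y‖ ≤ Real.posLog (‖x‖ + ‖y‖) :=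
      (le_max_right _ _).trans (Real.posLog_le_posLog (norm_nonneg _) (norm_sub_le x y))
    have h2 := Real.posLog_add (x := ‖x‖) (y := ‖y‖)
    have h3 := Real.log_two_lt_d9
    linarith
  have h1 : Real.log ‖x - y‖ ^ s ≤ 1 + (Real.posLog ‖x‖ ^ s + Real.posLog ‖y‖ ^ s) := by
    calc _ ≤ (1 + (Real.posLog ‖x‖ + Real.posLog ‖y‖)) ^ s :=
          Real.rpow_le_rpow (by linarith) h0 hs.1
      _ ≤ 1 ^ s + (Real.posLog ‖x‖ + Real.posLog ‖y‖) ^ s :=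
          Real.rpow_add_le_add_rpow (by norm_num) (by positivity) hs.1 hs.2.le
      _ ≤ _ := by
          rw [Real.one_rpow]
          gcongr
          exact Real.rpow_add_le_add_rpow hx hy hs.1 hs.2.le
  have a := Real.rpow_nonneg hx s
  have b := Real.rpow_nonneg hy s
  nlinarith [mul_nonneg a b]

lemma ptwise (s t : ℝ) (hs : s ∈ Set.Ico (0 : ℝ) 1) (ht : t = 1 ∨ t = 2) (α : ℝ)
    (hα : α ∈ Set.Ioo (0 : ℝ) (Real.exp 1)⁻¹) (x y : EuclideanSpace ℝ (Fin 2))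
    (h1 : 1 ≤ Real.log ‖x - y‖) (h2 : Real.log ‖x - y‖ < Real.sqrt |Real.log α|) :
    |G x y α - g α| ^ t ≤ 9 * |Real.log α| ^ ((t - s) / 2) *
      ((1 + Real.posLog ‖x‖ ^ s) * (1 + Real.posLog ‖y‖ ^ s)) := by
  obtain ⟨ha, ha1⟩ := hα
  have hlog : Real.log α < -1 := by
    have := Real.log_lt_log ha ha1
    rwa [Real.log_inv, Real.log_exp] at this
  have hL : |Real.log α| = - Real.log α := abs_of_neg (by linarith)
  set r := ‖x - y‖ with hr
  have hr0 : 0 < r := by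
    rcases (norm_nonneg (x - y)).lt_or_eq with h | h
    · exact h
    · rw [hr, ← h] at h1; simp at h1; linarith
  have hsq : Real.sqrt |Real.log α| ≤ - Real.log α := by
    rw [hL, Real.sqrt_le_left (by linarith)]; nlinarith
  have hlw : Real.log (α * r) = Real.log α + Real.log r := Real.log_mul ha.ne' hr0.ne'
  have hw : 0 < α * r := mul_pos ha hr0
  have hw1 : α * r ≤ 1 := by
    rw [← Real.log_nonpos_iff hw.le, hlw]; linarith
  have hK := K0_bound _ hw hw1
  have hpi := Real.pi_gt_three
  have hG : |G x y α - g α| ≤ 3 * Real.log r := by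
    have e : G x y α - g α = (1 / (2 * Real.pi)) * ((K0 (α * r) + Real.log (α * r)) - Real.log r) := by
      rw [hlw, G, g]; ring
    have hc : 1 / (2 * Real.pi) ≤ 1 := by
      rw [div_le_one (by positivity)]; linarith
    rw [e, abs_mul, abs_of_pos (by positivity : 0 < 1 / (2 * Real.pi))]
    have : |K0 (α * r) + Real.log (α * r) - Real.log r| ≤ 3 * Real.log r := by
      rw [abs_le] at hK ⊢; constructor <;> linarith [hK.1, hK.2]
    calc _ ≤ 1 * |K0 (α * r) + Real.log (α * r) - Real.log r| := by gcongr
      _ ≤ _ := by linarith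
  have hlr : 0 < Real.log r := by linarith
  have ht0 : 0 ≤ t - s := by have := hs.2; rcases ht with h | h <;> linarith
  calc |G x y α - g α| ^ t ≤ (3 * Real.log r) ^ t :=
        Real.rpow_le_rpow (abs_nonneg _) hG (by rcases ht with h | h <;> linarith)
    _ = 3 ^ t * (Real.log r ^ (t - s) * Real.log r ^ s) := by
        rw [Real.mul_rpow (by norm_num) hlr.le, ← Real.rpow_add hlr]; simp
    _ ≤ 9 * (|Real.log α| ^ ((t - s) / 2) *
          ((1 + Real.posLog ‖x‖ ^ s) * (1 + Real.posLog ‖y‖ ^ s))) := by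
        have k1 : (3:ℝ) ^ t ≤ 9 := by rcases ht with h | h <;> subst h <;> norm_num
        have k2 : Real.log r ^ (t - s) ≤ |Real.log α| ^ ((t - s) / 2) := by
          calc _ ≤ (Real.sqrt |Real.log α|) ^ (t - s) := Real.rpow_le_rpow hlr.le h2.le ht0
            _ = _ := by
              rw [Real.sqrt_eq_rpow, ← Real.rpow_mul (abs_nonneg _)]; congr 1; ring
        have k3 := log_aux s hs x y h1
        gcongr
    _ = _ := by ring

noncomputable def auxF (s : ℝ) (V : EuclideanSpace ℝ (Fin 2) → ℝ)
    (x : EuclideanSpace ℝ (Fin 2)) : ENNReal :=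
  ENNReal.ofReal ((1 + Real.posLog ‖x‖ ^ s) * |V x|)

lemma auxF_meas (s : ℝ) (V : EuclideanSpace ℝ (Fin 2) → ℝ) (hV : Integrable V) :
    AEMeasurable (auxF s V) := by
  have hVm : AEMeasurable V := hV.aestronglyMeasurable.aemeasurable
  have hpm : Measurable fun x : EuclideanSpace ℝ (Fin 2) => Real.posLog ‖x‖ := by
    unfold Real.posLog; fun_prop
  have hFm : AEMeasurable (auxF s V) := by
    unfold auxF
    apply AEMeasurable.ennreal_ofReal
    exact ((measurable_const.add (hpm.pow_const s)).aemeasurable).mul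
      (measurable_norm.comp_aemeasurable hVm)
  exact hFm

lemma auxF_fin (s : ℝ) (hs : s ∈ Set.Ico (0 : ℝ) 1)
    (V : EuclideanSpace ℝ (Fin 2) → ℝ) (hV : Integrable V)
    (hlns : ∫⁻ x in {x : EuclideanSpace ℝ (Fin 2) | 1 < ‖x‖},
      ENNReal.ofReal (|Real.log ‖x‖| ^ s * |V x|) < ⊤) :
    ∫⁻ x, auxF s V x < ⊤ := by
  have hVm : AEMeasurable V := hV.aestronglyMeasurable.aemeasurable
  have hVfin : ∫⁻ x, ENNReal.ofReal |V x| < ⊤ := by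
    have := hV.2
    rw [hasFiniteIntegral_iff_norm] at this
    exact this
  have hS : MeasurableSet {x : EuclideanSpace ℝ (Fin 2) | 1 < ‖x‖} :=
    measurableSet_lt measurable_const measurable_norm
  have hFfin : ∫⁻ x, auxF s V x < ⊤ := by
    have hle : ∀ x, auxF s V x ≤ 2 * ENNReal.ofReal |V x| +
        Set.indicator {x : EuclideanSpace ℝ (Fin 2) | 1 < ‖x‖}
          (fun x => ENNReal.ofReal (|Real.log ‖x‖| ^ s * |V x|)) x := by
      intro x
      by_cases hx : 1 < ‖x‖
      · have e : Real.posLog ‖x‖ = |Real.log ‖x‖| := by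
          have := Real.log_pos hx
          rw [Real.posLog, max_eq_right this.le, abs_of_pos this]
        rw [Set.indicator_of_mem (by exact hx), auxF]
        rw [e, add_mul, one_mul, ENNReal.ofReal_add (by positivity) (by positivity)]
        gcongr
        rw [two_mul]; exact le_self_add
      · have e : Real.posLog ‖x‖ = 0 := by
          rw [Real.posLog, max_eq_left (Real.log_nonpos (norm_nonneg _) (not_lt.1 hx))]
        rw [Set.indicator_of_notMem (by exact hx), auxF, add_zero]
        have h2 : (2 : ENNReal) = ENNReal.ofReal 2 := by simp
        rw [e, h2, ← ENNReal.ofReal_mul (by norm_num)]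
        apply ENNReal.ofReal_le_ofReal
        gcongr
        have := Real.rpow_le_one (le_refl (0:ℝ)) zero_le_one hs.1
        linarith
    refine (lintegral_mono hle).trans_lt ?_
    rw [lintegral_add_left' (by
      exact ((measurable_norm.comp_aemeasurable hVm).ennreal_ofReal).const_mul _),
      lintegral_const_mul' _ _ (by simp), lintegral_indicator hS]
    exact ENNReal.add_lt_top.2 ⟨ENNReal.mul_lt_top (by simp) hVfin, hlns⟩
  exact hFfin

lemma prod_aux {E : Type*} [MeasureSpace E] [SFinite (volume : Measure E)] (F : E → ENNReal)
    (hF : AEMeasurable F) (c : ENNReal) (hc : c ≠ ⊤) :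
    ∫⁻ p : E × E, c * (F p.1 * F p.2) = c * ((∫⁻ x, F x) * (∫⁻ x, F x)) := by
  rw [lintegral_const_mul' _ _ hc, Measure.volume_eq_prod, lintegral_prod_mul hF hF]

lemma Omega2_meas (α : ℝ) : MeasurableSet (Omega2 α) := by
  have : Measurable fun p : EuclideanSpace ℝ (Fin 2) × EuclideanSpace ℝ (Fin 2) =>
      Real.log ‖p.1 - p.2‖ := by fun_prop
  exact (measurableSet_le measurable_const this).inter (measurableSet_lt this measurable_const)

lemma step1 (s t : ℝ) (hs : s ∈ Set.Ico (0 : ℝ) 1) (ht : t = 1 ∨ t = 2) (α : ℝ)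
    (V : EuclideanSpace ℝ (Fin 2) → ℝ)
    (hα : α ∈ Set.Ioo (0 : ℝ) (Real.exp 1)⁻¹)
    (p : EuclideanSpace ℝ (Fin 2) × EuclideanSpace ℝ (Fin 2)) (hp : p ∈ Omega2 α) :
    ENNReal.ofReal (|V p.1| * |G p.1 p.2 α - g α| ^ t * |V p.2|) ≤
      ENNReal.ofReal (9 * |Real.log α| ^ ((t - s) / 2)) * (auxF s V p.1 * auxF s V p.2) := by
  have hx := Real.posLog_nonneg (x := ‖p.1‖)
  have hy := Real.posLog_nonneg (x := ‖p.2‖)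
  rw [auxF, auxF, ← ENNReal.ofReal_mul (by positivity), ← ENNReal.ofReal_mul (by positivity)]
  apply ENNReal.ofReal_le_ofReal
  calc _ ≤ |V p.1| * (9 * |Real.log α| ^ ((t - s) / 2) *
        ((1 + Real.posLog ‖p.1‖ ^ s) * (1 + Real.posLog ‖p.2‖ ^ s))) * |V p.2| := by
        gcongr
        exact ptwise s t hs ht α hα p.1 p.2 hp.1 hp.2
    _ = _ := by ring

/-- If `s ∈ [0,1)`, `t ∈ {1,2}` and `V ∈ L¹(ℝ²)` is real-valued and satisfies
(V_ln_s) and (V_roll), then there is `C > 0` such that for all `α ∈ (0,1/e)`: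
`∫_{Ω₂(α)} |V(x)|·|G(x,y;α) − g(α)|^t·|V(y)| d(x,y) ≤ C·|ln α|^{(t−s)/2}`. -/
theorem I2_bound (s t : ℝ) (hs : s ∈ Set.Ico (0 : ℝ) 1) (ht : t = 1 ∨ t = 2)
    (V : EuclideanSpace ℝ (Fin 2) → ℝ) (hV : Integrable V)
    (hlns : ∫⁻ x in {x : EuclideanSpace ℝ (Fin 2) | 1 < ‖x‖},
      ENNReal.ofReal (|Real.log ‖x‖| ^ s * |V x|) < ⊤)
    (hroll : ∫⁻ p in {p : EuclideanSpace ℝ (Fin 2) × EuclideanSpace ℝ (Fin 2) |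
        ‖p.1 - p.2‖ < Real.exp 1},
      ENNReal.ofReal (|V p.1| * (Real.log ‖p.1 - p.2‖) ^ 2 * |V p.2|) < ⊤) :
    ∃ C : ℝ, 0 < C ∧ ∀ α : ℝ, α ∈ Set.Ioo (0 : ℝ) (Real.exp 1)⁻¹ →
      ∫⁻ p in Omega2 α,
          ENNReal.ofReal (|V p.1| * |G p.1 p.2 α - g α| ^ t * |V p.2|) ≤
        ENNReal.ofReal (C * |Real.log α| ^ ((t - s) / 2)) := by
  have hFfin := auxF_fin s hs V hV hlns
  refine ⟨9 * ((∫⁻ x, auxF s V x).toReal * (∫⁻ x, auxF s V x).toReal) + 1, by positivity,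
    fun α hα => ?_⟩
  have hM0 : 0 ≤ |Real.log α| ^ ((t - s) / 2) := Real.rpow_nonneg (abs_nonneg _) _
  refine (setLIntegral_mono' (Omega2_meas α) (step1 s t hs ht α V hα)).trans ?_
  refine (setLIntegral_le_lintegral _ _).trans ?_
  rw [prod_aux (auxF s V) (auxF_meas s V hV) _ ENNReal.ofReal_ne_top]
  generalize (∫⁻ x, auxF s V x) = I at *
  generalize |Real.log α| ^ ((t - s) / 2) = M at *
  have e : ENNReal.ofReal (9 * M) * (I * I) = ENNReal.ofReal (9 * M * (I.toReal * I.toReal)) := by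
    rw [ENNReal.ofReal_mul (by positivity : 0 ≤ 9 * M),
      ENNReal.ofReal_mul ENNReal.toReal_nonneg, ENNReal.ofReal_toReal hFfin.ne]
  rw [e]
  exact ENNReal.ofReal_le_ofReal (by linarith)
end

section
/- Define V₀(x) := 1_{‖x‖<1/3}(x) / (‖x‖²·(ln‖x‖)⁴) for x ∈ ℝ². Then V₀ ∈ L¹(ℝ²), and the double integral ∫∫_{‖x−y‖<e} V₀(x)·(ln‖x−y‖)²·V₀(y) d(x,y) is finite, i.e., V₀ satisfies condition (V_roll); however, for every η > 0 one has ∫_{ℝ²} V₀(x)^{1+η} dx = ∞, so V₀ ∉ L^{1+η}(ℝ²) for any η > 0. -/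
open MeasureTheory

/-- The potential `V₀(x) = 1_{‖x‖<1/3}(x) / (‖x‖²·(ln‖x‖)⁴)`. -/
noncomputable def V0 (x : EuclideanSpace ℝ (Fin 2)) : ℝ :=
  Set.indicator {z : EuclideanSpace ℝ (Fin 2) | ‖z‖ < 1 / 3}
    (fun z => 1 / (‖z‖ ^ 2 * (Real.log ‖z‖) ^ 4)) x

lemma log_le_neg_one {r : ℝ} (h0 : 0 < r) (h : r < 1 / 3) :
    Real.log r ≤ - Real.log 3 ∧ 1 ≤ Real.log 3 := by
  constructor
  · rw [← Real.log_inv]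
    exact Real.log_le_log h0 (by norm_num at h ⊢; exact h.le)
  · rw [Real.le_log_iff_exp_le (by norm_num)]
    exact (Real.exp_one_lt_d9.trans (by norm_num)).le

lemma V0_nonneg (x : EuclideanSpace ℝ (Fin 2)) : 0 ≤ V0 x := by
  unfold V0
  apply Set.indicator_nonneg
  intro z _
  positivity

lemma V0_measurable : Measurable V0 := by
  unfold V0
  apply Measurable.indicator
  · fun_prop
  · exact measurableSet_lt measurable_norm measurable_const

lemma V0_of_lt {x : EuclideanSpace ℝ (Fin 2)} (h : ‖x‖ < 1 / 3) :
    V0 x = 1 / (‖x‖ ^ 2 * (Real.log ‖x‖) ^ 4) := by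
  unfold V0
  rw [Set.indicator_of_mem]
  exact h

lemma V0_of_ge {x : EuclideanSpace ℝ (Fin 2)} (h : ¬ ‖x‖ < 1 / 3) :
    V0 x = 0 := by
  unfold V0
  rw [Set.indicator_of_notMem]
  exact h

lemma V0_zero : V0 0 = 0 := by
  rw [V0_of_lt (by norm_num)]
  simp

lemma integrableOn_aux : IntegrableOn (fun r : ℝ => r⁻¹ / (Real.log r) ^ 2) (Set.Ioc 0 (1 / 3)) := by
  refine intervalIntegral.integrableOn_deriv_of_nonneg (g := fun r => - (Real.log r)⁻¹) ?_ ?_ ?_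
  · intro r hr
    apply ContinuousAt.continuousWithinAt
    rcases hr.1.eq_or_lt with h | h
    · subst h
      apply ContinuousAt.neg
      rw [continuousAt_iff_punctured_nhds]
      simp only [Real.log_zero, inv_zero]
      exact tendsto_inv_atBot_zero.comp Real.tendsto_log_nhdsNE_zero
    · have : Real.log r ≠ 0 := (Real.log_neg h (by linarith [hr.2])).ne
      have h' := h.ne'
      exact ((Real.continuousAt_log h').inv₀ this).neg
  · intro r hr
    have : Real.log r ≠ 0 := (Real.log_neg hr.1 (by linarith [hr.2])).ne
    have := ((Real.hasDerivAt_log hr.1.ne').inv this).neg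
    have e : r⁻¹ / Real.log r ^ 2 = -(-r⁻¹ / Real.log r ^ 2) := by ring
    rw [e]
    exact this
  · intro r hr
    have := hr.1
    positivity

lemma W_integrable :
    Integrable (fun x : EuclideanSpace ℝ (Fin 2) => V0 x * (Real.log ‖x‖) ^ 2) := by
  have h := (integrable_fun_norm_addHaar (volume : Measure (EuclideanSpace ℝ (Fin 2)))
    (f := Set.indicator (Set.Iio (1 / 3 : ℝ))
      (fun r => 1 / (r ^ 2 * (Real.log r) ^ 4) * (Real.log r) ^ 2))).2 ?_
  · refine h.congr (Filter.Eventually.of_forall fun x => ?_)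
    by_cases hx : ‖x‖ < 1 / 3
    · simp only [V0_of_lt hx]
      rw [Set.indicator_of_mem (by exact hx)]
    · simp only [V0_of_ge hx]
      rw [Set.indicator_of_notMem (by exact hx)]
      simp
  · have h1 : IntegrableOn (Set.indicator (Set.Ioc 0 (1 / 3))
      (fun r : ℝ => r⁻¹ / (Real.log r) ^ 2)) (Set.Ioi 0) :=
      ((integrable_indicator_iff measurableSet_Ioc).2 integrableOn_aux).integrableOn
    refine h1.congr ?_
    have hne : ∀ᵐ r : ℝ ∂(volume.restrict (Set.Ioi 0)), r ≠ 1 / 3 :=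
      ae_restrict_of_ae (Measure.ae_ne volume _)
    filter_upwards [hne, ae_restrict_mem measurableSet_Ioi] with r hr hr0
    have hr0' : 0 < r := hr0
    simp only [finrank_euclideanSpace, Fintype.card_fin]
    by_cases hx : r < 1 / 3
    · rw [Set.indicator_of_mem (by exact ⟨hr0, hx.le⟩), Set.indicator_of_mem (by exact hx)]
      have : Real.log r ≠ 0 := (Real.log_neg hr0 (by linarith)).ne
      simp
      field_simp
    · rw [Set.indicator_of_notMem (by rintro ⟨_, h⟩; exact hr (le_antisymm h (not_lt.1 hx))),
        Set.indicator_of_notMem (by exact hx)]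
      simp

lemma V0_integrable : Integrable V0 := by
  refine W_integrable.mono' V0_measurable.aestronglyMeasurable (Filter.Eventually.of_forall fun x => ?_)
  rw [Real.norm_of_nonneg (V0_nonneg x)]
  by_cases hx : ‖x‖ < 1 / 3
  · by_cases h0 : x = 0
    · simp [h0, V0_zero]
    · have := log_le_neg_one (norm_pos_iff.2 h0) hx
      exact le_mul_of_one_le_right (V0_nonneg x) (by nlinarith)
  · simp [V0_of_ge hx]

lemma g_bound (a b ρ : ℝ) (ha : 0 ≤ a) (hb : 0 ≤ b) (hρ : 0 < ρ) :
    Integrable (fun z : EuclideanSpace ℝ (Fin 2) =>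
      Set.indicator (Set.Iio ρ) (fun r => a + b / r) ‖z‖) ∧
    ∫ z : EuclideanSpace ℝ (Fin 2), Set.indicator (Set.Iio ρ) (fun r => a + b / r) ‖z‖ ≤
      2 * (volume.real (Metric.ball (0 : EuclideanSpace ℝ (Fin 2)) 1) * ((a * ρ + b) * ρ)) := by
  have hc : IntegrableOn (Set.indicator (Set.Ioo 0 ρ) (fun _ : ℝ => a * ρ + b)) (Set.Ioi 0) := by
    refine ((integrable_indicator_iff measurableSet_Ioo).2 ?_).integrableOn
    exact integrableOn_const (by simp)
  have hpt : ∀ r ∈ Set.Ioi (0:ℝ), 0 ≤ r * Set.indicator (Set.Iio ρ) (fun r => a + b / r) r ∧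
      r * Set.indicator (Set.Iio ρ) (fun r => a + b / r) r ≤
      Set.indicator (Set.Ioo 0 ρ) (fun _ : ℝ => a * ρ + b) r := by
    intro r hr
    have hr' : 0 < r := hr
    by_cases h : r < ρ
    · rw [Set.indicator_of_mem (by exact h), Set.indicator_of_mem (by exact ⟨hr, h⟩)]
      refine ⟨by positivity, ?_⟩
      have : r * (a + b / r) = a * r + b := by field_simp
      rw [this]
      gcongr
    · rw [Set.indicator_of_notMem (by exact h), Set.indicator_of_notMem (by exact fun h' => h h'.2)]
      simp
  have hi : IntegrableOn (fun r : ℝ => r * Set.indicator (Set.Iio ρ) (fun r => a + b / r) r)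
      (Set.Ioi 0) := by
    refine Integrable.mono' hc ?_ ?_
    · apply Measurable.aestronglyMeasurable
      apply measurable_id.mul
      apply Measurable.indicator _ measurableSet_Iio
      fun_prop
    · filter_upwards [ae_restrict_mem measurableSet_Ioi] with r hr
      rw [Real.norm_of_nonneg (hpt r hr).1]
      exact (hpt r hr).2
  constructor
  · rw [integrable_fun_norm_addHaar]
    simpa using hi
  · rw [integral_fun_norm_addHaar]
    simp only [finrank_euclideanSpace, Fintype.card_fin, smul_eq_mul, nsmul_eq_mul,
      Nat.add_one_sub_one, pow_one, Nat.cast_ofNat]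
    gcongr
    have h2 : ∫ r in Set.Ioi 0, Set.indicator (Set.Ioo 0 ρ) (fun _ : ℝ => a * ρ + b) r
        = (a * ρ + b) * ρ := by
      rw [setIntegral_indicator measurableSet_Ioo,
        Set.inter_eq_self_of_subset_right Set.Ioo_subset_Ioi_self]
      simp [hρ.le]
      ring
    rw [← h2]
    exact setIntegral_mono_on hi hc measurableSet_Ioi (fun r hr => (hpt r hr).2)

lemma pt_bound (x y : EuclideanSpace ℝ (Fin 2)) (hx0 : x ≠ 0) (hx : ‖x‖ < 1 / 3) :
    (Real.log ‖x - y‖) ^ 2 * V0 y ≤ 4 * (Real.log ‖x‖) ^ 2 * V0 y +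
      Set.indicator (Set.Iio (‖x‖ / 2)) (fun r =>
        (64 / (‖x‖ ^ 2 * (Real.log ‖x‖) ^ 4)) * (2 * (Real.log ‖x‖) ^ 2) +
        (64 / (‖x‖ ^ 2 * (Real.log ‖x‖) ^ 4)) * (8 * ‖x‖) / r) ‖x - y‖ := by
  have hV := V0_nonneg y
  have hnn : 0 ≤ Set.indicator (Set.Iio (‖x‖ / 2)) (fun r =>
        (64 / (‖x‖ ^ 2 * (Real.log ‖x‖) ^ 4)) * (2 * (Real.log ‖x‖) ^ 2) +
        (64 / (‖x‖ ^ 2 * (Real.log ‖x‖) ^ 4)) * (8 * ‖x‖) / r) ‖x - y‖ := by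
    by_cases h : ‖x - y‖ < ‖x‖ / 2
    · rw [Set.indicator_of_mem (by exact h)]
      positivity
    · rw [Set.indicator_of_notMem (by exact h)]
  by_cases hy : ‖y‖ < 1 / 3
  swap
  · rw [V0_of_ge hy]
    simpa using hnn
  have hxp : 0 < ‖x‖ := norm_pos_iff.2 hx0
  obtain ⟨hl1, hl3⟩ := log_le_neg_one hxp hx
  have h23 : Real.log 2 ≤ Real.log 3 := Real.log_le_log (by norm_num) (by norm_num)
  have hL0 : Real.log ‖x‖ < 0 := by linarith
  by_cases h : ‖x - y‖ < ‖x‖ / 2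
  · rw [Set.indicator_of_mem (by exact h)]
    have hy1 : ‖x‖ / 2 ≤ ‖y‖ := by
      have := norm_sub_norm_le x y
      linarith
    have hy2 : ‖y‖ ≤ 3 / 2 * ‖x‖ := by
      have := norm_sub_norm_le y x
      rw [norm_sub_rev] at this
      linarith
    have hyp : 0 < ‖y‖ := by linarith
    have hly : Real.log ‖y‖ ≤ Real.log ‖x‖ / 2 := by
      have h1 := Real.log_le_log hyp hy2
      rw [Real.log_mul (by norm_num) hxp.ne'] at h1
      have h2 : Real.log (3 / 2) * 2 ≤ Real.log 3 := by
        have : Real.log (3 / 2) * 2 = Real.log ((3 / 2) ^ 2) := by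
          rw [Real.log_pow]; push_cast; ring
        rw [this]
        exact Real.log_le_log (by norm_num) (by norm_num)
      linarith
    have hVy : V0 y ≤ 64 / (‖x‖ ^ 2 * (Real.log ‖x‖) ^ 4) := by
      rw [V0_of_lt hy]
      have e : 64 / (‖x‖ ^ 2 * (Real.log ‖x‖) ^ 4)
          = 1 / ((‖x‖ / 2) ^ 2 * (- Real.log ‖x‖ / 2) ^ 4) := by
        have := hL0.ne
        field_simp
        norm_num
      have e2 : (Real.log ‖y‖) ^ 4 = (- Real.log ‖y‖) ^ 4 := by ring
      rw [e, e2]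
      have : 0 < - Real.log ‖x‖ / 2 := by linarith
      apply one_div_le_one_div_of_le (by positivity)
      gcongr
      linarith
    have hlog : (Real.log ‖x - y‖) ^ 2 ≤ 2 * (Real.log ‖x‖) ^ 2 + 8 * ‖x‖ / ‖x - y‖ := by
      rcases (norm_nonneg (x - y)).eq_or_lt with h0 | h0
      · rw [← h0]; simp; positivity
      · have hu : 1 ≤ ‖x‖ / ‖x - y‖ := by
          rw [one_le_div h0]; linarith
        have hlu : Real.log (‖x‖ / ‖x - y‖) ≤ 2 * Real.sqrt (‖x‖ / ‖x - y‖) := by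
          have h1 := Real.log_le_self (Real.sqrt_nonneg (‖x‖ / ‖x - y‖))
          rw [Real.log_sqrt (by positivity)] at h1
          linarith
        have hlu0 := Real.log_nonneg hu
        have hlu2 : (Real.log (‖x‖ / ‖x - y‖)) ^ 2 ≤ 4 * (‖x‖ / ‖x - y‖) := by
          have := pow_le_pow_left₀ hlu0 hlu 2
          rw [mul_pow, Real.sq_sqrt (by positivity)] at this
          linarith
        rw [Real.log_div hxp.ne' h0.ne'] at hlu2
        have : 8 * ‖x‖ / ‖x - y‖ = 2 * (4 * (‖x‖ / ‖x - y‖)) := by ring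
        rw [this]
        nlinarith [sq_nonneg (2 * Real.log ‖x‖ - Real.log ‖x - y‖)]
    have hm := mul_le_mul hlog hVy hV (by positivity)
    refine hm.trans ?_
    have : 0 ≤ 4 * (Real.log ‖x‖) ^ 2 * V0 y := by positivity
    refine le_trans (le_of_eq ?_) (le_add_of_nonneg_left this)
    ring
  · have h' := not_lt.1 h
    have hz : ‖x - y‖ ≤ 1 := by
      have := norm_sub_le x y
      linarith
    have hl := Real.log_le_log (by positivity) h'
    rw [Real.log_div hxp.ne' (by norm_num)] at hl
    have hz0 := Real.log_nonpos (norm_nonneg _) hz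
    have hsq : (Real.log ‖x - y‖) ^ 2 ≤ 4 * (Real.log ‖x‖) ^ 2 := by
      nlinarith
    have := mul_le_mul_of_nonneg_right hsq hV
    linarith

lemma inner_bound : ∃ C : ℝ, ∀ x : EuclideanSpace ℝ (Fin 2),
    ∫⁻ y, ENNReal.ofReal (V0 x * (Real.log ‖x - y‖) ^ 2 * V0 y) ≤
      ENNReal.ofReal (C * (V0 x * (Real.log ‖x‖) ^ 2)) := by
  set v := volume.real (Metric.ball (0 : EuclideanSpace ℝ (Fin 2)) 1) with hv
  have hv0 : 0 ≤ v := by simp [hv]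
  refine ⟨4 * (∫ y, V0 y) + 576 * v, fun x => ?_⟩
  by_cases hx : ‖x‖ < 1 / 3
  swap
  · simp [V0_of_ge hx]
  by_cases hx0 : x = 0
  · simp [hx0, V0_zero]
  have hxp : 0 < ‖x‖ := norm_pos_iff.2 hx0
  obtain ⟨hl1, hl3⟩ := log_le_neg_one hxp hx
  set L := Real.log ‖x‖ with hL
  have hLne : L ≠ 0 := by linarith
  obtain ⟨gi, gb⟩ := g_bound ((64 / (‖x‖ ^ 2 * L ^ 4)) * (2 * L ^ 2))
    ((64 / (‖x‖ ^ 2 * L ^ 4)) * (8 * ‖x‖)) (‖x‖ / 2) (by positivity) (by positivity) (by positivity)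
  have gi' := gi.comp_sub_left x
  have hG : Integrable (fun y => V0 x * (4 * L ^ 2 * V0 y + Set.indicator (Set.Iio (‖x‖ / 2)) (fun r =>
        (64 / (‖x‖ ^ 2 * L ^ 4)) * (2 * L ^ 2) +
        (64 / (‖x‖ ^ 2 * L ^ 4)) * (8 * ‖x‖) / r) ‖x - y‖)) :=
    ((V0_integrable.const_mul _).add gi').const_mul _
  calc _ ≤ ∫⁻ y, ENNReal.ofReal (V0 x * (4 * L ^ 2 * V0 y + Set.indicator (Set.Iio (‖x‖ / 2)) (fun r =>
        (64 / (‖x‖ ^ 2 * L ^ 4)) * (2 * L ^ 2) +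
        (64 / (‖x‖ ^ 2 * L ^ 4)) * (8 * ‖x‖) / r) ‖x - y‖)) := by
        refine lintegral_mono fun y => ENNReal.ofReal_le_ofReal ?_
        rw [mul_assoc]
        exact mul_le_mul_of_nonneg_left (pt_bound x y hx0 hx) (V0_nonneg x)
    _ = ENNReal.ofReal (∫ y, V0 x * (4 * L ^ 2 * V0 y + Set.indicator (Set.Iio (‖x‖ / 2)) (fun r =>
        (64 / (‖x‖ ^ 2 * L ^ 4)) * (2 * L ^ 2) +
        (64 / (‖x‖ ^ 2 * L ^ 4)) * (8 * ‖x‖) / r) ‖x - y‖)) := by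
        rw [ofReal_integral_eq_lintegral_ofReal hG]
        refine Filter.Eventually.of_forall fun y => ?_
        refine mul_nonneg (V0_nonneg x) (le_trans ?_ (pt_bound x y hx0 hx))
        exact mul_nonneg (sq_nonneg _) (V0_nonneg y)
    _ ≤ _ := by
        apply ENNReal.ofReal_le_ofReal
        rw [integral_const_mul, integral_add (V0_integrable.const_mul _) gi', integral_const_mul,
          integral_sub_left_eq_self (fun z : EuclideanSpace ℝ (Fin 2) =>
            Set.indicator (Set.Iio (‖x‖ / 2)) (fun r =>
        (64 / (‖x‖ ^ 2 * L ^ 4)) * (2 * L ^ 2) +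
        (64 / (‖x‖ ^ 2 * L ^ 4)) * (8 * ‖x‖) / r) ‖z‖) volume x]
        have h1 : 2 * (v * ((64 / (‖x‖ ^ 2 * L ^ 4) * (2 * L ^ 2) * (‖x‖ / 2) +
            64 / (‖x‖ ^ 2 * L ^ 4) * (8 * ‖x‖)) * (‖x‖ / 2))) = 64 * v * ((L ^ 2 + 8) / L ^ 4) := by
          field_simp
        rw [h1] at gb
        have h2 : (L ^ 2 + 8) / L ^ 4 ≤ 9 * L ^ 2 := by
          have hL1 : 1 ≤ L ^ 2 := by nlinarith
          rw [div_le_iff₀ (by positivity)]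
          have h4 : 1 ≤ L ^ 4 := by nlinarith
          nlinarith
        have h3 : 64 * v * ((L ^ 2 + 8) / L ^ 4) ≤ 64 * v * (9 * L ^ 2) := by gcongr
        have := mul_le_mul_of_nonneg_left (gb.trans h3) (V0_nonneg x)
        linarith

lemma not_Lp (η : ℝ) (hη : 0 < η) :
    ∫⁻ x : EuclideanSpace ℝ (Fin 2), ENNReal.ofReal (V0 x ^ (1 + η)) = ⊤ := by
  by_contra hne
  have hint : Integrable (fun x => V0 x ^ (1 + η)) := by
    refine (lintegral_ofReal_ne_top_iff_integrable ?_ ?_).1 hne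
    · exact (V0_measurable.pow_const _).aestronglyMeasurable
    · exact Filter.Eventually.of_forall fun x => Real.rpow_nonneg (V0_nonneg x) _
  have h1 : Integrable (fun x : EuclideanSpace ℝ (Fin 2) =>
      (fun r => (Set.indicator (Set.Iio (1 / 3 : ℝ))
      (fun r => 1 / (r ^ 2 * (Real.log r) ^ 4)) r) ^ (1 + η)) ‖x‖) := hint
  replace h1 := (integrable_fun_norm_addHaar (volume : Measure (EuclideanSpace ℝ (Fin 2)))
    (f := fun r => (Set.indicator (Set.Iio (1 / 3 : ℝ))
      (fun r => 1 / (r ^ 2 * (Real.log r) ^ 4)) r) ^ (1 + η))).1 h1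
  simp only [finrank_euclideanSpace, Fintype.card_fin, Nat.reduceSub, pow_one, smul_eq_mul] at h1
  have ho := (isLittleO_abs_log_rpow_rpow_nhdsGT_zero (4 * (1 + η))
    (s := -(2 * η)) (by linarith)).bound (c := 1) one_pos
  obtain ⟨δ, hδ, hδs⟩ := mem_nhdsGT_iff_exists_Ioo_subset.1 ho
  have hδ0 : 0 < δ := hδ
  set d := min δ (1 / 3) with hd
  have hd0 : 0 < d := by positivity
  have h2 : IntegrableOn (fun r : ℝ => r⁻¹) (Set.Ioo 0 d) := by
    refine Integrable.mono' (h1.mono_set Set.Ioo_subset_Ioi_self) (by fun_prop) ?_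
    filter_upwards [ae_restrict_mem measurableSet_Ioo] with r hr
    have hr0 : 0 < r := hr.1
    have hr3 : r < 1 / 3 := hr.2.trans_le (min_le_right _ _)
    have hb := hδs ⟨hr0, hr.2.trans_le (min_le_left _ _)⟩
    simp only [Set.mem_setOf_eq, one_mul] at hb
    rw [Real.norm_of_nonneg (by positivity), Real.norm_of_nonneg (by positivity)] at hb
    rw [Real.norm_of_nonneg (by positivity), Set.indicator_of_mem (by exact hr3)]
    have hl : Real.log r ≠ 0 := (Real.log_neg hr0 (by linarith)).ne
    have hla : 0 < |Real.log r| := abs_pos.2 hl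
    have e : (1 / (r ^ 2 * (Real.log r) ^ 4)) ^ (1 + η)
        = (r ^ (2 + 2 * η) * |Real.log r| ^ (4 * (1 + η)))⁻¹ := by
      rw [one_div, Real.inv_rpow (by positivity), Real.mul_rpow (by positivity) (by positivity)]
      congr 2
      · rw [← Real.rpow_natCast, ← Real.rpow_mul hr0.le]
        congr 1; push_cast; ring
      · have : Real.log r ^ 4 = |Real.log r| ^ 4 := by
          rw [Even.pow_abs (by decide)]
        rw [this, ← Real.rpow_natCast, ← Real.rpow_mul hla.le]
        norm_num
    rw [e]
    have h3 : r ^ (2 + 2 * η) * |Real.log r| ^ (4 * (1 + η)) ≤ r ^ 2 := by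
      calc _ ≤ r ^ (2 + 2 * η) * r ^ (-(2 * η)) := by gcongr
        _ = r ^ 2 := by
          rw [← Real.rpow_add hr0]
          norm_num
    calc r⁻¹ = r * (r ^ 2)⁻¹ := by field_simp
      _ ≤ _ := by gcongr
  have h3 : IntervalIntegrable (fun r : ℝ => r⁻¹) volume 0 d := by
    rw [intervalIntegrable_iff_integrableOn_Ioo_of_le hd0.le]
    exact h2
  rw [intervalIntegrable_inv_iff] at h3
  rcases h3 with h | h
  · exact hd0.ne h
  · exact h Set.left_mem_uIcc

/-- `V₀ ∈ L¹(ℝ²)`, `V₀` satisfies condition (V_roll), but for every `η > 0` one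
has `∫ V₀^{1+η} = ∞`, i.e. `V₀ ∉ L^{1+η}(ℝ²)` for any `η > 0`. -/
theorem V0_roll_but_not_Lp :
    Integrable V0 ∧
    (∫⁻ p in {p : EuclideanSpace ℝ (Fin 2) × EuclideanSpace ℝ (Fin 2) |
        ‖p.1 - p.2‖ < Real.exp 1},
      ENNReal.ofReal (V0 p.1 * (Real.log ‖p.1 - p.2‖) ^ 2 * V0 p.2) < ⊤) ∧
    ∀ η : ℝ, 0 < η →
      ∫⁻ x : EuclideanSpace ℝ (Fin 2), ENNReal.ofReal (V0 x ^ (1 + η)) = ⊤ := by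
  refine ⟨V0_integrable, ?_, not_Lp⟩
  obtain ⟨C, hC⟩ := inner_bound
  refine lt_of_le_of_lt (setLIntegral_le_lintegral _ _) ?_
  have hm := V0_measurable
  rw [Measure.volume_eq_prod, lintegral_prod _ (by fun_prop)]
  refine lt_of_le_of_lt (lintegral_mono hC) ?_
  exact (W_integrable.const_mul C).lintegral_lt_top
end
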